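/- arXiv:math/0501430 — 7 statements merged into one kernel-verified Lean document; each statement's English description precedes it below -/
import Mathlib

section
/- Let L be a lattice. The partially ordered set M₃[L] of all balanced triples is a lattice if and only if M₃[L] is a closure system in L³, that is, for every triple t ∈ L³ there exists a least balanced triple u with t ≤ u componentwise. -/
/-- A triple `(x, y, z)` in a lattice is *balanced* if `x ⊓ y = x ⊓ z = y ⊓ z`. -/
def IsBalanced {α : Type*} [Lattice α] (t : α × α × α) : Prop :=
  t.1 ⊓ t.2.1 = t.1 ⊓ t.2.2 ∧ t.1 ⊓ t.2.2 = t.2.1 ⊓ t.2.2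

/-- `M₃[L]`, the poset of balanced triples of `L` (ordered componentwise), is a lattice
(i.e., every pair of balanced triples has a least upper bound; binary meets it already has,
being a meet-subsemilattice of `L³`) if and only if it is a closure system in `L³`:
every triple of `L³` lies below a least balanced triple. -/
theorem stmt0 {α : Type*} [Lattice α] :
    (∀ a b : {t : α × α × α // IsBalanced t}, ∃ c, IsLUB {a, b} c) ↔
    (∀ t : α × α × α, ∃ u : α × α × α, IsBalanced u ∧ t ≤ u ∧
      ∀ v : α × α × α, IsBalanced v → t ≤ v → u ≤ v) := by
  constructor
  · rintro h ⟨x, y, z⟩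
    have hx : x ⊓ y ⊓ z ≤ x := inf_le_left.trans inf_le_left
    have hy : x ⊓ y ⊓ z ≤ y := inf_le_left.trans inf_le_right
    have hz : x ⊓ y ⊓ z ≤ z := inf_le_right
    generalize x ⊓ y ⊓ z = m at hx hy hz
    obtain ⟨c, hc⟩ := h ⟨(x, m, m), by simp [IsBalanced, hx]⟩ ⟨(m, y, m), by simp [IsBalanced, hy]⟩
    obtain ⟨d, hd⟩ := h c ⟨(m, m, z), by simp [IsBalanced, hz]⟩
    have hcd : c ≤ d := hd.1 (by simp)
    have hxd := (hc.1 (Set.mem_insert _ _)).trans hcd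
    have hyd := (hc.1 (Set.mem_insert_of_mem _ rfl)).trans hcd
    have hzd := hd.1 (Set.mem_insert_of_mem _ rfl)
    refine ⟨d, d.2, ⟨hxd.1, hyd.2.1, hzd.2.2⟩, fun v hv htv => ?_⟩
    obtain ⟨hvx, hvy, hvz⟩ := htv
    have hmx : m ≤ v.1 := hx.trans hvx
    have hmy : m ≤ v.2.1 := hy.trans hvy
    have hmz : m ≤ v.2.2 := hz.trans hvz
    have hcv : c ≤ ⟨v, hv⟩ := hc.2 (by
      rintro _ (rfl | rfl)
      · exact ⟨hvx, hmy, hmz⟩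
      · exact ⟨hmx, hvy, hmz⟩)
    have hdv : d ≤ ⟨v, hv⟩ := hd.2 (by
      rintro _ (rfl | rfl)
      · exact hcv
      · exact ⟨hmx, hmy, hvz⟩)
    exact hdv
  · intro h a b
    obtain ⟨u, hu, hle, hmin⟩ := h (a.1 ⊔ b.1)
    refine ⟨⟨u, hu⟩, ?_, fun v hv => ?_⟩
    · rintro _ (rfl | rfl)
      · exact le_sup_left.trans hle
      · exact le_sup_right.trans hle
    · exact hmin v.1 v.2 (sup_le (hv (Set.mem_insert _ _)) (hv (Set.mem_insert_of_mem _ rfl)))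
end

section
/- A lattice L is 1-modular (satisfies the identity γ₁) if and only if L is modular, i.e., a ≤ c implies a ⊔ (b ⊓ c) = (a ⊔ b) ⊓ c for all a, b, c ∈ L. -/
/-- One step of the balancing sequence: sends `(x, y, z)` to
`(x ⊔ (y ⊓ z), y ⊔ (x ⊓ z), z ⊔ (x ⊓ y))`; thus
`(adjT^[n] (x,y,z)) = (pₙ(x,y,z), qₙ(x,y,z), rₙ(x,y,z))`. -/
def adjT {α : Type*} [Lattice α] (t : α × α × α) : α × α × α :=
  (t.1 ⊔ t.2.1 ⊓ t.2.2, t.2.1 ⊔ t.1 ⊓ t.2.2, t.2.2 ⊔ t.1 ⊓ t.2.1)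

/-- A lattice is `n`-modular (satisfies the identity `γₙ : pₙ = pₙ₊₁`). -/
def NModular (α : Type*) [Lattice α] (n : ℕ) : Prop :=
  ∀ t : α × α × α, (adjT^[n] t).1 = (adjT^[n + 1] t).1

/-- A lattice is `1`-modular if and only if it is modular. -/
theorem stmt2 (α : Type*) [Lattice α] :
    NModular α 1 ↔ ∀ a b c : α, a ≤ c → a ⊔ b ⊓ c = (a ⊔ b) ⊓ c := by
  constructor
  · intro h a b c hac
    have key : a ⊔ b ⊓ c = (a ⊔ b ⊓ c) ⊔ (b ⊔ a ⊓ c) ⊓ (c ⊔ a ⊓ b) := h (a, b, c)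
    rw [inf_eq_left.2 hac, sup_eq_left.2 (inf_le_left.trans hac : a ⊓ b ≤ c),
      sup_comm b a] at key
    apply le_antisymm
    · exact sup_le (le_inf le_sup_left hac) (inf_le_inf_right c le_sup_right)
    · rw [key]
      exact le_sup_right
  · rintro h ⟨x, y, z⟩
    change x ⊔ y ⊓ z = (x ⊔ y ⊓ z) ⊔ (y ⊔ x ⊓ z) ⊓ (z ⊔ x ⊓ y)
    refine (sup_eq_left.2 ?_).symm
    have hz : (y ⊔ x ⊓ z) ⊓ z = x ⊓ z ⊔ y ⊓ z := by
      rw [sup_comm y, h _ _ _ inf_le_right]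
    have hq : x ⊓ y ≤ y ⊔ x ⊓ z := inf_le_right.trans le_sup_left
    rw [inf_comm, sup_comm z, ← h _ _ _ hq, inf_comm z, hz]
    exact sup_le (inf_le_left.trans le_sup_left) (sup_le_sup_right inf_le_left _)
end

section
/- The five-element lattice N₅ = {0, a, b, c, 1} in which 0 < b < a < 1, 0 < c < 1, and c is incomparable with both a and b (so a ⊓ c = b ⊓ c = 0 and a ⊔ c = b ⊔ c = 1) is 2-modular, i.e., satisfies the identity γ₂. -/
/-- The five-element lattice `N₅ = {o, a, b, c, i}` with `o < b < a < i`, `o < c < i`,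
`c` incomparable with `a` and `b`, `a ⊓ c = b ⊓ c = o`, `a ⊔ c = b ⊔ c = i`,
is `2`-modular. -/
theorem stmt3 (α : Type*) [Lattice α] (o a b c i : α)
    (hall : ∀ x : α, x = o ∨ x = a ∨ x = b ∨ x = c ∨ x = i)
    (h1 : o < b) (h2 : b < a) (h3 : a < i) (h4 : o < c) (h5 : c < i)
    (h6 : ¬ a ≤ c) (h7 : ¬ c ≤ a) (h8 : ¬ b ≤ c) (h9 : ¬ c ≤ b)
    (hac : a ⊓ c = o) (hbc : b ⊓ c = o) (hacj : a ⊔ c = i) (hbcj : b ⊔ c = i) :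
    NModular α 2 := by
  have hob := h1.le
  have hba := h2.le
  have hai := h3.le
  have hoc := h4.le
  have hci := h5.le
  have hoa := hob.trans hba
  have hbi := hba.trans hai
  have hoi := hoc.trans hci
  have hca : c ⊓ a = o := by rw [inf_comm, hac]
  have hcb : c ⊓ b = o := by rw [inf_comm, hbc]
  have hcaj : c ⊔ a = i := by rw [sup_comm, hacj]
  have hcbj : c ⊔ b = i := by rw [sup_comm, hbcj]
  rintro ⟨x, y, z⟩
  rcases hall x with rfl | rfl | rfl | rfl | rfl <;>
  rcases hall y with rfl | rfl | rfl | rfl | rfl <;>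
  rcases hall z with rfl | rfl | rfl | rfl | rfl <;>
  simp only [adjT, Function.iterate_succ, Function.iterate_zero, Function.comp_apply, id_eq,
    sup_idem, inf_idem, sup_of_le_left, sup_of_le_right, inf_of_le_left, inf_of_le_right, *]
end

section
/- Let L be a lattice such that the poset M₃[L] of balanced triples is a lattice. Then M₃[L] is a modular lattice if and only if L is a distributive lattice. -/
section ModularLattice

variable {α : Type*} [Lattice α] [IsModularLattice α]

theorem inf_sup_inf_le_sup_inf (x y z : α) :
    (x ⊓ (y ⊔ z) ⊔ y ⊓ z) ⊓ (y ⊓ (x ⊔ z) ⊔ x ⊓ z) ≤ x ⊓ y ⊔ x ⊓ z ⊔ y ⊓ z := by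
  have hyz : y ⊓ z ≤ y ⊓ (x ⊔ z) ⊔ x ⊓ z :=
    le_sup_of_le_left (inf_le_inf_left _ le_sup_right)
  rw [sup_comm (x ⊓ (y ⊔ z)), sup_inf_assoc_of_le _ hyz]
  refine sup_le le_sup_right (le_sup_of_le_left ?_)
  calc x ⊓ (y ⊔ z) ⊓ (y ⊓ (x ⊔ z) ⊔ x ⊓ z)
      ≤ (x ⊓ z ⊔ y) ⊓ x :=
        le_inf (inf_le_right.trans
          (sup_le (inf_le_left.trans le_sup_right) le_sup_left))
          (inf_le_left.trans inf_le_left)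
    _ = x ⊓ z ⊔ y ⊓ x := sup_inf_assoc_of_le y inf_le_left
    _ ≤ x ⊓ y ⊔ x ⊓ z := by rw [sup_comm, inf_comm y x]

theorem inf_sup_le_inf_sup_sup_inf_sup (x y z : α) :
    x ⊓ (y ⊔ z) ≤ y ⊓ (x ⊔ z) ⊔ z ⊓ (x ⊔ y) := by
  rw [← sup_inf_assoc_of_le z (inf_le_left.trans le_sup_right : y ⊓ (x ⊔ z) ≤ x ⊔ y),
    sup_comm (y ⊓ (x ⊔ z)), inf_comm y, inf_comm (x ⊔ z),
    ← sup_inf_assoc_of_le y (le_sup_right : z ≤ x ⊔ z)]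
  refine le_inf (le_inf ?_ (inf_le_left.trans le_sup_left)) (inf_le_left.trans le_sup_left)
  rw [sup_comm z y]
  exact inf_le_right

/-- In a modular lattice, distributivity only has to be tested on diamonds. -/
theorem inf_sup_eq_of_forall_diamond
    (h : ∀ o a b c : α, a ⊓ b = o → a ⊓ c = o → b ⊓ c = o → a ≤ b ⊔ c → a ≤ o)
    (x y z : α) : x ⊓ (y ⊔ z) = x ⊓ y ⊔ x ⊓ z := by
  have hxy : x ⊓ y ⊔ x ⊓ z ⊔ y ⊓ z ≤ x ⊓ (y ⊔ z) ⊔ y ⊓ z :=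
    sup_le_sup_right le_inf_sup _
  have hyx : x ⊓ y ⊔ x ⊓ z ⊔ y ⊓ z ≤ y ⊓ (x ⊔ z) ⊔ x ⊓ z :=
    sup_le (sup_le (le_sup_of_le_left (le_inf inf_le_right (inf_le_left.trans le_sup_left)))
      le_sup_right) (le_sup_of_le_left (inf_le_inf_left _ le_sup_right))
  have hzx : x ⊓ y ⊔ x ⊓ z ⊔ y ⊓ z ≤ z ⊓ (x ⊔ y) ⊔ x ⊓ y :=
    sup_le (sup_le le_sup_right
      (le_sup_of_le_left (le_inf inf_le_right (inf_le_left.trans le_sup_left))))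
      (le_sup_of_le_left (le_inf inf_le_right (inf_le_left.trans le_sup_right)))
  have key := h (x ⊓ y ⊔ x ⊓ z ⊔ y ⊓ z) (x ⊓ (y ⊔ z) ⊔ y ⊓ z) (y ⊓ (x ⊔ z) ⊔ x ⊓ z)
    (z ⊓ (x ⊔ y) ⊔ x ⊓ y)
    (le_antisymm (inf_sup_inf_le_sup_inf x y z) (le_inf hxy hyx))
    (le_antisymm
      (by simpa only [sup_comm, inf_comm, sup_left_comm] using inf_sup_inf_le_sup_inf x z y)
      (le_inf hxy hzx))
    (le_antisymm
      (by simpa only [sup_comm, inf_comm, sup_left_comm, sup_assoc] using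
        inf_sup_inf_le_sup_inf y z x)
      (le_inf hyx hzx))
    (sup_le ((inf_sup_le_inf_sup_sup_inf_sup x y z).trans
      (sup_le_sup le_sup_left le_sup_left))
      (le_sup_right.trans (hyx.trans le_sup_left)))
  refine le_antisymm ?_ le_inf_sup
  calc x ⊓ (y ⊔ z) ≤ (x ⊓ y ⊔ x ⊓ z ⊔ y ⊓ z) ⊓ x := le_inf (le_sup_left.trans key) inf_le_left
    _ = x ⊓ y ⊔ x ⊓ z ⊔ y ⊓ z ⊓ x :=
        sup_inf_assoc_of_le _ (sup_le inf_le_left inf_le_left)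
    _ ≤ x ⊓ y ⊔ x ⊓ z :=
        sup_le le_rfl (le_sup_of_le_left (le_inf inf_le_right (inf_le_left.trans inf_le_left)))

end ModularLattice

namespace IsBalanced

variable {α : Type*}

theorem of_le [Lattice α] {x y z : α} (hz : x ⊓ y ≤ z) (hy : x ⊓ z ≤ y) (hx : y ⊓ z ≤ x) :
    IsBalanced (x, y, z) :=
  ⟨le_antisymm (le_inf inf_le_left hz) (le_inf inf_le_left hy),
    le_antisymm (le_inf hy inf_le_right) (le_inf hx inf_le_right)⟩

theorem inf_le_thd [Lattice α] {t : α × α × α} (h : IsBalanced t) : t.1 ⊓ t.2.1 ≤ t.2.2 :=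
  h.1.trans_le inf_le_right

theorem inf_le_snd [Lattice α] {t : α × α × α} (h : IsBalanced t) : t.1 ⊓ t.2.2 ≤ t.2.1 :=
  h.1.symm.trans_le inf_le_right

theorem inf_le_fst [Lattice α] {t : α × α × α} (h : IsBalanced t) : t.2.1 ⊓ t.2.2 ≤ t.1 :=
  h.2.symm.trans_le inf_le_left

theorem inf [Lattice α] {s t : α × α × α} (hs : IsBalanced s) (ht : IsBalanced t) :
    IsBalanced (s ⊓ t) :=
  of_le
    (le_inf ((inf_le_inf inf_le_left inf_le_left).trans hs.inf_le_thd)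
      ((inf_le_inf inf_le_right inf_le_right).trans ht.inf_le_thd))
    (le_inf ((inf_le_inf inf_le_left inf_le_left).trans hs.inf_le_snd)
      ((inf_le_inf inf_le_right inf_le_right).trans ht.inf_le_snd))
    (le_inf ((inf_le_inf inf_le_left inf_le_left).trans hs.inf_le_fst)
      ((inf_le_inf inf_le_right inf_le_right).trans ht.inf_le_fst))

/-- Over a distributive lattice, every triple is made balanced by joining to each component the
meet of the other two. -/
theorem sup_inf [DistribLattice α] (x y z : α) :
    IsBalanced (x ⊔ y ⊓ z, y ⊔ x ⊓ z, z ⊔ x ⊓ y) := by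
  refine of_le ?_ ?_ ?_ <;> simp only [inf_sup_left, inf_sup_right, sup_le_iff] <;>
    refine ⟨⟨?_, ?_⟩, ?_, ?_⟩ <;> order

end IsBalanced

theorem sup_sup_inf_sup_inf_le {α : Type*} [DistribLattice α]
    {a₁ a₂ a₃ b₁ b₂ b₃ c₁ c₂ c₃ t₁ t₂ t₃ : α} (ha₂ : a₂ ≤ c₂) (ha₃ : a₃ ≤ c₃)
    (hb : b₂ ⊓ b₃ ≤ b₁) (hc₃ : c₁ ⊓ c₂ ≤ c₃) (hc₂ : c₁ ⊓ c₃ ≤ c₂) (ht : t₂ ⊓ t₃ ≤ t₁)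
    (hat₁ : a₁ ≤ t₁) (hat₂ : a₂ ≤ t₂) (hat₃ : a₃ ≤ t₃)
    (hbt₁ : b₁ ⊓ c₁ ≤ t₁) (hbt₂ : b₂ ⊓ c₂ ≤ t₂) (hbt₃ : b₃ ⊓ c₃ ≤ t₃) :
    (a₁ ⊔ b₁ ⊔ (a₂ ⊔ b₂) ⊓ (a₃ ⊔ b₃)) ⊓ c₁ ≤ t₁ := by
  simp only [inf_sup_left, inf_sup_right, sup_le_iff]
  refine ⟨⟨inf_le_left.trans hat₁, hbt₁⟩, ⟨?_, ?_⟩, ?_, ?_⟩ <;> order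

/-- Let `L` be a lattice such that the poset `M₃[L]` of balanced triples is a lattice,
with join operation `j` and meet operation `m` (characterized order-theoretically by
`IsLUB`/`IsGLB`).  Then `M₃[L]` is modular if and only if `L` is distributive. -/
theorem stmt4 {α : Type*} [Lattice α]
    (j m : {t : α × α × α // IsBalanced t} → {t : α × α × α // IsBalanced t} →
      {t : α × α × α // IsBalanced t})
    (hj : ∀ a b, IsLUB {a, b} (j a b)) (hm : ∀ a b, IsGLB {a, b} (m a b)) :
    (∀ a b c : {t : α × α × α // IsBalanced t}, a ≤ c → j a (m b c) = m (j a b) c) ↔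
    (∀ x y z : α, x ⊓ (y ⊔ z) = x ⊓ y ⊔ x ⊓ z) := by
  have le_j_left (a b) : a ≤ j a b := (hj a b).1 (by simp)
  have le_j_right (a b) : b ≤ j a b := (hj a b).1 (by simp)
  have j_le {a b c} (ha : a ≤ c) (hb : b ≤ c) : j a b ≤ c := (hj a b).2 (by simp [ha, hb])
  have m_le_left (a b) : m a b ≤ a := (hm a b).1 (by simp)
  have m_le_right (a b) : m a b ≤ b := (hm a b).1 (by simp)
  have le_m {a b c} (ha : c ≤ a) (hb : c ≤ b) : c ≤ m a b := (hm a b).2 (by simp [ha, hb])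
  constructor
  · intro h
    have le_of_modular {a b c t v : {t : α × α × α // IsBalanced t}} (hac : a ≤ c) (htc : t ≤ c)
        (htj : t ≤ j a b) (hav : a ≤ v) (hmv : m b c ≤ v) : t ≤ v :=
      (le_m htj htc).trans ((h a b c hac).symm.trans_le (j_le hav hmv))
    let diag (x : α) : {t : α × α × α // IsBalanced t} := ⟨(x, x, x), rfl, rfl⟩
    have diag_le {x y : α} (hxy : x ≤ y) : diag x ≤ diag y := ⟨hxy, hxy, hxy⟩
    have : IsModularLattice α := ⟨fun {x} y {z} hxz => by
      have hab := le_j_left (diag x) (diag y)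
      have hba := le_j_right (diag x) (diag y)
      have hbc := m_le_left (diag y) (diag z)
      have hcb := m_le_right (diag y) (diag z)
      refine (le_of_modular (a := diag x) (b := diag y) (c := diag z)
        (t := diag ((x ⊔ y) ⊓ z)) (v := diag (x ⊔ y ⊓ z)) (diag_le hxz)
        (diag_le inf_le_right) ?_ (diag_le le_sup_left) ?_).1
      · exact ⟨inf_le_left.trans (sup_le hab.1 hba.1),
          inf_le_left.trans (sup_le hab.2.1 hba.2.1), inf_le_left.trans (sup_le hab.2.2 hba.2.2)⟩
      · exact ⟨le_sup_of_le_right (le_inf hbc.1 hcb.1),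
          le_sup_of_le_right (le_inf hbc.2.1 hcb.2.1),
          le_sup_of_le_right (le_inf hbc.2.2 hcb.2.2)⟩⟩
    refine inf_sup_eq_of_forall_diamond fun o a b c hab hac hbc hle => ?_
    have hoa : o ≤ a := hab ▸ inf_le_left
    -- The triples `(b ⊔ c, o, o) ≤ (b ⊔ c, a, a)` and `(a, b, c)` generate a pentagon.
    let A : {t : α × α × α // IsBalanced t} := ⟨(b ⊔ c, o, o), rfl, by
      have : o ≤ b ⊔ c := hoa.trans hle
      simpa using this⟩
    let B : {t : α × α × α // IsBalanced t} := ⟨(a, b, c), hab.trans hac.symm, hac.trans hbc.symm⟩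
    let C : {t : α × α × α // IsBalanced t} := ⟨(b ⊔ c, a, a), rfl, by simpa using hle⟩
    have hA : A ≤ j A B := le_j_left A B
    have hB : B ≤ j A B := le_j_right A B
    have hb : b ≤ (j A B).1.2.2 :=
      (le_inf (le_sup_left.trans hA.1) hB.2.1).trans (j A B).2.inf_le_thd
    have hc : c ≤ (j A B).1.2.1 :=
      (le_inf (le_sup_right.trans hA.1) hB.2.2).trans (j A B).2.inf_le_snd
    have hBC := m_le_left B C
    have hCB := m_le_right B C
    refine (le_of_modular (a := A) (b := B) (c := C) (t := C) (v := A) ⟨le_rfl, hoa, hoa⟩ le_rfl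
      ⟨hA.1, hle.trans (sup_le hB.2.1 hc), hle.trans (sup_le hb hB.2.2)⟩ le_rfl ?_).2.1
    exact ⟨hCB.1, (le_inf hCB.2.1 hBC.2.1).trans hab.le, (le_inf hCB.2.2 hBC.2.2).trans hac.le⟩
  · intro h a b c hac
    let _ : DistribLattice α := DistribLattice.ofInfSupLe fun x y z => (h x y z).le
    refine le_antisymm (j_le (le_m (le_j_left a b) hac)
      (le_m ((m_le_left b c).trans (le_j_right a b)) (m_le_right b c))) ?_
    have hja : j a b ≤ ⟨_, IsBalanced.sup_inf (a.1.1 ⊔ b.1.1) (a.1.2.1 ⊔ b.1.2.1)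
        (a.1.2.2 ⊔ b.1.2.2)⟩ :=
      j_le ⟨le_sup_of_le_left le_sup_left, le_sup_of_le_left le_sup_left,
          le_sup_of_le_left le_sup_left⟩
        ⟨le_sup_of_le_left le_sup_right, le_sup_of_le_left le_sup_right,
          le_sup_of_le_left le_sup_right⟩
    have hml := (m_le_left (j a b) c).trans hja
    have hmr := m_le_right (j a b) c
    have hat := le_j_left a (m b c)
    have hbt : b.1 ⊓ c.1 ≤ (j a (m b c)).1 :=
      (le_m (c := ⟨b.1 ⊓ c.1, b.2.inf c.2⟩) (inf_le_left : b.1 ⊓ c.1 ≤ b.1)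
        (inf_le_right : b.1 ⊓ c.1 ≤ c.1)).trans (le_j_right a (m b c))
    have ht := (j a (m b c)).2
    refine ⟨(le_inf hml.1 hmr.1).trans ?_, (le_inf hml.2.1 hmr.2.1).trans ?_,
      (le_inf hml.2.2 hmr.2.2).trans ?_⟩
    · exact sup_sup_inf_sup_inf_le hac.2.1 hac.2.2 b.2.inf_le_fst c.2.inf_le_thd c.2.inf_le_snd
        ht.inf_le_fst hat.1 hat.2.1 hat.2.2 hbt.1 hbt.2.1 hbt.2.2
    · exact sup_sup_inf_sup_inf_le hac.1 hac.2.2 b.2.inf_le_snd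
        (inf_comm c.1.1 c.1.2.1 ▸ c.2.inf_le_thd) c.2.inf_le_fst
        ht.inf_le_snd hat.2.1 hat.1 hat.2.2 hbt.2.1 hbt.1 hbt.2.2
    · exact sup_sup_inf_sup_inf_le hac.1 hac.2.1 b.2.inf_le_thd
        (inf_comm c.1.1 c.1.2.2 ▸ c.2.inf_le_snd) (inf_comm c.1.2.1 c.1.2.2 ▸ c.2.inf_le_fst)
        ht.inf_le_thd hat.2.2 hat.1 hat.2.1 hbt.2.2 hbt.1 hbt.2.1
end

section
/- Let n > 0 and let L be an n-modular lattice. Then the poset M₃[L] of balanced triples is a lattice, in which the meet of two balanced triples is componentwise and the join of (x₀, y₀, z₀) and (x₁, y₁, z₁) is (x₀ ⊔ x₁, y₀ ⊔ y₁, z₀ ⊔ z₁)^{(n)}. Moreover, if L is bounded with bottom 0 and top 1, then the five balanced triples (0,0,0), (1,0,0), (0,1,0), (0,0,1), (1,1,1) form a sublattice of M₃[L] containing the bounds of M₃[L] and isomorphic to M₃ (a spanning M₃). -/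
/-- A triple is balanced iff each entry dominates the meet of the other two. -/
theorem isBalanced_iff {α : Type*} [Lattice α] {t : α × α × α} :
    IsBalanced t ↔ t.2.1 ⊓ t.2.2 ≤ t.1 ∧ t.1 ⊓ t.2.2 ≤ t.2.1 ∧ t.1 ⊓ t.2.1 ≤ t.2.2 := by
  constructor
  · rintro ⟨h₁, h₂⟩
    exact ⟨h₂ ▸ inf_le_left, h₁ ▸ inf_le_right, h₁ ▸ inf_le_right⟩
  · rintro ⟨hx, hy, hz⟩
    exact ⟨le_antisymm (le_inf inf_le_left hz) (le_inf inf_le_left hy),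
      le_antisymm (le_inf hy inf_le_right) (le_inf hx inf_le_right)⟩

theorem isBalanced_iff_isFixedPt {α : Type*} [Lattice α] {t : α × α × α} :
    IsBalanced t ↔ Function.IsFixedPt adjT t := by
  simp [isBalanced_iff, Function.IsFixedPt, adjT, Prod.ext_iff]

theorem monotone_adjT {α : Type*} [Lattice α] : Monotone (adjT : α × α × α → α × α × α) :=
  fun _ _ ⟨hx, hy, hz⟩ => ⟨sup_le_sup hx (inf_le_inf hy hz), sup_le_sup hy (inf_le_inf hx hz),
    sup_le_sup hz (inf_le_inf hx hy)⟩

theorem le_adjT {α : Type*} [Lattice α] (t : α × α × α) : t ≤ adjT t :=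
  ⟨le_sup_left, le_sup_left, le_sup_left⟩

theorem IsBalanced.inf_s5 {α : Type*} [Lattice α] {s t : α × α × α} (hs : IsBalanced s)
    (ht : IsBalanced t) : IsBalanced (s ⊓ t) := by
  rw [isBalanced_iff] at *
  obtain ⟨hs₁, hs₂, hs₃⟩ := hs
  obtain ⟨ht₁, ht₂, ht₃⟩ := ht
  simp only [Prod.fst_inf, Prod.snd_inf]
  rw [inf_inf_inf_comm s.2.1, inf_inf_inf_comm s.1 t.1 s.2.2, inf_inf_inf_comm s.1 t.1 s.2.1]
  exact ⟨inf_le_inf hs₁ ht₁, inf_le_inf hs₂ ht₂, inf_le_inf hs₃ ht₃⟩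

/-- In an `n`-modular lattice, `n`-fold adjustment balances every triple. -/
theorem NModular.isBalanced_iterate_adjT {α : Type*} [Lattice α] {n : ℕ} (h : NModular α n)
    (t : α × α × α) : IsBalanced (adjT^[n] t) := by
  have hy : Function.Commute (fun t : α × α × α => (t.2.1, t.1, t.2.2)) adjT := fun t => by
    simp only [adjT, inf_comm]
  have hz : Function.Commute (fun t : α × α × α => (t.2.2, t.2.1, t.1)) adjT := fun t => by
    simp only [adjT, inf_comm]
  have ey (k : ℕ) : (adjT^[k] (t.2.1, t.1, t.2.2)).1 = (adjT^[k] t).2.1 :=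
    (congrArg Prod.fst (hy.iterate_right k t)).symm
  have ez (k : ℕ) : (adjT^[k] (t.2.2, t.2.1, t.1)).1 = (adjT^[k] t).2.2 :=
    (congrArg Prod.fst (hz.iterate_right k t)).symm
  rw [isBalanced_iff_isFixedPt, Function.IsFixedPt, ← Function.iterate_succ_apply' adjT]
  refine Prod.ext (h t).symm (Prod.ext ?_ ?_)
  · rw [← ey, ← ey, h]
  · rw [← ez, ← ez, h]

/-- If `L` is `n`-modular (`n > 0`), then the poset `M₃[L]` of balanced triples is a lattice:
the meet of two balanced triples is componentwise, and their join is the `n`-fold adjustment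
`(x₀ ⊔ x₁, y₀ ⊔ y₁, z₀ ⊔ z₁)⁽ⁿ⁾` of the componentwise join.  Moreover, if `L` is bounded, then
the balanced triples `(0,0,0), (1,0,0), (0,1,0), (0,0,1), (1,1,1)` form a sublattice of `M₃[L]`
containing the bounds of `M₃[L]` and isomorphic to `M₃` (a spanning `M₃`). -/
theorem stmt5 {α : Type*} [Lattice α] (n : ℕ) (hn : 0 < n) (h : NModular α n) :
    (∀ a b : {t : α × α × α // IsBalanced t}, ∃ s : {t : α × α × α // IsBalanced t},
      (s : α × α × α) = adjT^[n] ((a : α × α × α) ⊔ b) ∧ IsLUB {a, b} s) ∧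
    (∀ a b : {t : α × α × α // IsBalanced t}, ∃ m : {t : α × α × α // IsBalanced t},
      (m : α × α × α) = (a : α × α × α) ⊓ b ∧ IsGLB {a, b} m) ∧
    (∀ [BoundedOrder α],
      ∃ e₀ e₁ e₂ e₃ e₄ : {t : α × α × α // IsBalanced t},
        (e₀ : α × α × α) = (⊥, ⊥, ⊥) ∧ (e₁ : α × α × α) = (⊤, ⊥, ⊥) ∧
        (e₂ : α × α × α) = (⊥, ⊤, ⊥) ∧ (e₃ : α × α × α) = (⊥, ⊥, ⊤) ∧
        (e₄ : α × α × α) = (⊤, ⊤, ⊤) ∧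
        (∀ u : {t : α × α × α // IsBalanced t}, e₀ ≤ u ∧ u ≤ e₄) ∧
        (e₁ : α × α × α) ⊓ (e₂ : α × α × α) = (e₀ : α × α × α) ∧
        (e₁ : α × α × α) ⊓ (e₃ : α × α × α) = (e₀ : α × α × α) ∧
        (e₂ : α × α × α) ⊓ (e₃ : α × α × α) = (e₀ : α × α × α) ∧
        IsLUB {e₁, e₂} e₄ ∧ IsLUB {e₁, e₃} e₄ ∧ IsLUB {e₂, e₃} e₄ ∧
        ((⊥ : α) ≠ ⊤ → [e₀, e₁, e₂, e₃, e₄].Pairwise (· ≠ ·))) := by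
  refine ⟨fun a b => ⟨⟨_, h.isBalanced_iterate_adjT _⟩, rfl, ?_, fun u hu => ?_⟩,
    fun a b => ⟨⟨_, a.2.inf_s5 b.2⟩, rfl, ?_, fun u hu => ?_⟩, ?_⟩
  · have hle := Function.id_le_iterate_of_id_le (f := adjT) le_adjT n (a.1 ⊔ b.1)
    rintro u (rfl | rfl)
    · exact le_sup_left.trans hle
    · exact le_sup_right.trans hle
  · have hab : a.1 ⊔ b.1 ≤ u.1 := sup_le (hu (Or.inl rfl)) (hu (Or.inr rfl))
    have hle := monotone_adjT.iterate n hab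
    rwa [((isBalanced_iff_isFixedPt.1 u.2).iterate n).eq] at hle
  · rintro u (rfl | rfl)
    · exact Subtype.coe_le_coe.1 inf_le_left
    · exact Subtype.coe_le_coe.1 inf_le_right
  · exact Subtype.coe_le_coe.1 (le_inf (hu (Or.inl rfl)) (hu (Or.inr rfl)))
  · intro _
    refine ⟨⟨(⊥, ⊥, ⊥), by simp [IsBalanced]⟩, ⟨(⊤, ⊥, ⊥), by simp [IsBalanced]⟩,
      ⟨(⊥, ⊤, ⊥), by simp [IsBalanced]⟩, ⟨(⊥, ⊥, ⊤), by simp [IsBalanced]⟩,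
      ⟨(⊤, ⊤, ⊤), by simp [IsBalanced]⟩, rfl, rfl, rfl, rfl, rfl,
      fun u => ⟨⟨bot_le, bot_le, bot_le⟩, ⟨le_top, le_top, le_top⟩⟩,
      by simp, by simp, by simp, ?_, ?_, ?_, ?_⟩
    · refine ⟨fun _ _ => ⟨le_top, le_top, le_top⟩, fun u hub => ?_⟩
      have hx : ⊤ ≤ u.1.1 := (hub (Or.inl rfl)).1
      have hy : ⊤ ≤ u.1.2.1 := (hub (Or.inr rfl)).2.1
      exact ⟨hx, hy, (le_inf hx hy).trans (isBalanced_iff.1 u.2).2.2⟩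
    · refine ⟨fun _ _ => ⟨le_top, le_top, le_top⟩, fun u hub => ?_⟩
      have hx : ⊤ ≤ u.1.1 := (hub (Or.inl rfl)).1
      have hz : ⊤ ≤ u.1.2.2 := (hub (Or.inr rfl)).2.2
      exact ⟨hx, (le_inf hx hz).trans (isBalanced_iff.1 u.2).2.1, hz⟩
    · refine ⟨fun _ _ => ⟨le_top, le_top, le_top⟩, fun u hub => ?_⟩
      have hy : ⊤ ≤ u.1.2.1 := (hub (Or.inl rfl)).2.1
      have hz : ⊤ ≤ u.1.2.2 := (hub (Or.inr rfl)).2.2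
      exact ⟨(le_inf hy hz).trans (isBalanced_iff.1 u.2).1, hy, hz⟩
    · intro hne
      refine List.Pairwise.of_map (S := (· ≠ ·)) Subtype.val (fun _ _ => mt (congrArg _)) ?_
      simp [hne, hne.symm]
end

section
/- For every n ≥ 1 there exists a finite lattice that is (n+1)-modular but not n-modular; consequently, the class of n-modular lattices is properly contained in the class of (n+1)-modular lattices for every n ≥ 1. -/
section Symmetry

variable {α : Type*}

/-- Cyclic rotation of a triple. -/
def rotT (t : α × α × α) : α × α × α := (t.2.1, t.2.2, t.1)

/-- Exchange of the first two entries of a triple. -/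
def swapT (t : α × α × α) : α × α × α := (t.2.1, t.1, t.2.2)

theorem rotT_injective : Function.Injective (rotT (α := α)) := fun s t h => by
  simp only [rotT, Prod.mk.injEq] at h
  exact Prod.ext h.2.2 (Prod.ext h.1 h.2.1)

theorem swapT_injective : Function.Injective (swapT (α := α)) := fun s t h => by
  simp only [swapT, Prod.mk.injEq] at h
  exact Prod.ext h.2.1 (Prod.ext h.1 h.2.2)

variable [Lattice α]

theorem adjT_semiconj_rotT : Function.Semiconj (rotT (α := α)) adjT adjT := fun t => by
  simp [rotT, adjT, inf_comm]

theorem adjT_semiconj_swapT : Function.Semiconj (swapT (α := α)) adjT adjT := fun t => by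
  simp [swapT, adjT, inf_comm]

theorem NModular.iterate_eq {n : ℕ} (h : NModular α n) (t : α × α × α) :
    adjT^[n] t = adjT^[n + 1] t := by
  have h₁ := h (rotT t)
  have h₂ := h (rotT (rotT t))
  simp only [← (adjT_semiconj_rotT.iterate_right _).eq] at h₁ h₂
  exact Prod.ext (h t) (Prod.ext h₁ h₂)

theorem NModular.succ {n : ℕ} (h : NModular α n) : NModular α (n + 1) := fun t => by
  rw [Function.iterate_succ_apply' adjT n, Function.iterate_succ_apply' adjT (n + 1),
    h.iterate_eq t]

theorem NModular.mono {m n : ℕ} (h : NModular α m) (hmn : m ≤ n) : NModular α n :=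
  Nat.le_induction h (fun _ _ ih => ih.succ) n hmn

theorem adjT_stable_of_fst_le {t : α × α × α} (h : t.1 ≤ t.2.1) :
    adjT^[3] t = adjT^[2] t := by
  obtain ⟨x, y, z⟩ := t
  simp only at h
  have h₁ : adjT (x, y, z) = (x ⊔ y ⊓ z, y, z ⊔ x) := by
    have : x ⊓ z ≤ y := inf_le_left.trans h
    simp [adjT, h, this]
  have hxy : x ⊔ y ⊓ z ≤ y := sup_le h inf_le_left
  have h₂ : adjT (x ⊔ y ⊓ z, y, z ⊔ x) = (y ⊓ (z ⊔ x), y, z ⊔ x) := by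
    have a : (x ⊔ y ⊓ z) ⊓ (z ⊔ x) ≤ y := inf_le_left.trans hxy
    have b : x ⊔ y ⊓ z ≤ z ⊔ x := sup_le le_sup_right (inf_le_right.trans le_sup_left)
    have c : x ⊔ y ⊓ z ≤ y ⊓ (z ⊔ x) := le_inf hxy b
    rw [adjT]
    simp only [sup_eq_right.2 c, sup_eq_left.2 a, inf_eq_left.2 hxy, sup_eq_left.2 b]
  have h₃ : adjT (y ⊓ (z ⊔ x), y, z ⊔ x) = (y ⊓ (z ⊔ x), y, z ⊔ x) := by
    have a : y ⊓ (z ⊔ x) ⊓ y ≤ z ⊔ x := inf_le_left.trans inf_le_right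
    have b : y ⊓ (z ⊔ x) ⊓ (z ⊔ x) ≤ y := inf_le_left.trans inf_le_left
    rw [adjT]
    simp only [sup_idem, sup_eq_left.2 a, sup_eq_left.2 b]
  simp only [Function.iterate_succ_apply, Function.iterate_zero_apply, h₁, h₂, h₃]

theorem adjT_stable_rotT {t : α × α × α} (h : adjT^[3] (rotT t) = adjT^[2] (rotT t)) :
    adjT^[3] t = adjT^[2] t := by
  simp only [← (adjT_semiconj_rotT.iterate_right _).eq] at h
  exact rotT_injective h

theorem adjT_stable_swapT {t : α × α × α} (h : adjT^[3] (swapT t) = adjT^[2] (swapT t)) :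
    adjT^[3] t = adjT^[2] t := by
  simp only [← (adjT_semiconj_swapT.iterate_right _).eq] at h
  exact swapT_injective h

end Symmetry

section Minimal

variable {α : Type*} [Lattice α]

/-- The union of a principal ideal and a principal filter, as a sublattice. -/
def idealFilter (b c : α) : Sublattice α where
  carrier := {u | u ≤ b ∨ c ≤ u}
  supClosed' := by
    rintro u (hu | hu) v (hv | hv)
    · exact Or.inl (sup_le hu hv)
    · exact Or.inr (hv.trans le_sup_right)
    · exact Or.inr (hu.trans le_sup_left)
    · exact Or.inr (hu.trans le_sup_left)
  infClosed' := by
    rintro u (hu | hu) v (hv | hv)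
    · exact Or.inl (inf_le_left.trans hu)
    · exact Or.inl (inf_le_left.trans hu)
    · exact Or.inl (inf_le_right.trans hv)
    · exact Or.inr (le_inf hu hv)

/-- If the entries of `adjT t` generate the lattice, the balancing sequence from `adjT t` is
constant from its second step on. -/
theorem adjT_stable_of_generates (t : α × α × α)
    (h : ∀ M : Sublattice α, (adjT t).1 ∈ M → (adjT t).2.1 ∈ M → (adjT t).2.2 ∈ M → M = ⊤) :
    adjT^[3] (adjT t) = adjT^[2] (adjT t) := by
  obtain ⟨x, y, z⟩ := t
  have key (b c u : α) (h₁ : (adjT (x, y, z)).1 ≤ b ∨ c ≤ (adjT (x, y, z)).1)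
      (h₂ : (adjT (x, y, z)).2.1 ≤ b ∨ c ≤ (adjT (x, y, z)).2.1)
      (h₃ : (adjT (x, y, z)).2.2 ≤ b ∨ c ≤ (adjT (x, y, z)).2.2) : u ≤ b ∨ c ≤ u := by
    have : u ∈ idealFilter b c := by rw [h (idealFilter b c) h₁ h₂ h₃]; trivial
    exact this
  obtain ⟨x', hx⟩ : ∃ a, a = (adjT (x, y, z)).1 := ⟨_, rfl⟩
  obtain ⟨y', hy⟩ : ∃ a, a = (adjT (x, y, z)).2.1 := ⟨_, rfl⟩
  obtain ⟨z', hz⟩ : ∃ a, a = (adjT (x, y, z)).2.2 := ⟨_, rfl⟩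
  have ht : adjT (x, y, z) = (x', y', z') := by rw [hx, hy, hz]
  rw [ht] at key ⊢
  simp only at key
  simp only [adjT] at hx hy hz
  have yx' : y ⊓ z ≤ x' := hx ▸ le_sup_right
  have xy' : x ⊓ z ≤ y' := hy ▸ le_sup_right
  have xz' : x ⊓ y ≤ z' := hz ▸ le_sup_right
  have xx : x ≤ x' := hx ▸ le_sup_left
  have yy : y ≤ y' := hy ▸ le_sup_left
  have zz : z ≤ z' := hz ▸ le_sup_left
  have dx (u : α) : u ≤ x' ∨ y' ⊓ z' ≤ u :=
    key _ _ _ (.inl le_rfl) (.inr inf_le_left) (.inr inf_le_right)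
  have dy (u : α) : u ≤ y' ∨ x' ⊓ z' ≤ u :=
    key _ _ _ (.inr inf_le_left) (.inl le_rfl) (.inr inf_le_right)
  have dz (u : α) : u ≤ z' ∨ x' ⊓ y' ≤ u :=
    key _ _ _ (.inr inf_le_left) (.inr inf_le_right) (.inl le_rfl)
  rcases dy x with a₁ | a₁
  · refine adjT_stable_of_fst_le ?_
    exact hx ▸ sup_le a₁ (inf_le_left.trans yy)
  rcases dz x with a₂ | a₂
  · refine adjT_stable_swapT (adjT_stable_rotT (adjT_stable_of_fst_le ?_))
    exact hx ▸ sup_le a₂ (inf_le_right.trans zz)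
  rcases dx y with a₃ | a₃
  · refine adjT_stable_swapT (adjT_stable_of_fst_le ?_)
    exact hy ▸ sup_le a₃ (inf_le_left.trans xx)
  rcases dz y with a₄ | a₄
  · refine adjT_stable_rotT (adjT_stable_of_fst_le ?_)
    exact hy ▸ sup_le a₄ (inf_le_right.trans zz)
  rcases dx z with a₅ | a₅
  · refine adjT_stable_rotT (adjT_stable_rotT (adjT_stable_of_fst_le ?_))
    exact hz ▸ sup_le a₅ (inf_le_left.trans xx)
  rcases dy z with a₆ | a₆
  · refine adjT_stable_rotT (adjT_stable_swapT (adjT_stable_of_fst_le ?_))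
    exact hz ▸ sup_le a₆ (inf_le_right.trans yy)
  have fixed : Function.IsFixedPt adjT (x', y', z') := by
    rw [Function.IsFixedPt, adjT]
    simp only [sup_eq_left.2 ((le_inf a₃ a₅).trans yx'), sup_eq_left.2 ((le_inf a₁ a₆).trans xy'),
      sup_eq_left.2 ((le_inf a₂ a₄).trans xz')]
  rw [(fixed.iterate 3).eq, (fixed.iterate 2).eq]

/-- Componentwise inclusion of triples from a sublattice. -/
def coeT {M : Sublattice α} (t : M × M × M) : α × α × α := (t.1, t.2.1, t.2.2)

theorem adjT_semiconj_coeT (M : Sublattice α) :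
    Function.Semiconj (coeT (M := M)) adjT adjT := fun _ => rfl

end Minimal

theorem exists_nModular_succ_of_not_nModular {n : ℕ} (hn : 2 ≤ n) {α : Type} [Lattice α] [Finite α]
    (hα : ¬ NModular α n) :
    ∃ (β : Type) (_ : Lattice β), Finite β ∧ NModular β (n + 1) ∧ ¬ NModular β n := by
  induction hN : Nat.card α using Nat.strong_induction_on generalizing α with
  | _ N ih =>
  by_cases hs : NModular α (n + 1)
  · exact ⟨α, _, inferInstance, hs, hα⟩
  by_cases hM : ∃ M : Sublattice α, M ≠ ⊤ ∧ ¬ NModular M n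
  · obtain ⟨M, hM, hMn⟩ := hM
    refine ih _ ?_ hMn rfl
    have hlt : (M : Set α) ⊂ Set.univ :=
      Set.ssubset_univ_iff.2 fun h => hM (SetLike.coe_injective h)
    rw [← hN, ← Set.ncard_univ α]
    exact Set.ncard_lt_ncard hlt
  · push Not at hM
    simp only [NModular, not_forall] at hs
    obtain ⟨t, ht⟩ := hs
    refine absurd ?_ ht
    have hst : adjT^[3] (adjT t) = adjT^[2] (adjT t) := by
      refine adjT_stable_of_generates t fun M h₁ h₂ h₃ => by_contra fun hne => ht ?_
      have := congrArg coeT ((hM M hne).iterate_eq (⟨_, h₁⟩, ⟨_, h₂⟩, ⟨_, h₃⟩))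
      simp only [((adjT_semiconj_coeT M).iterate_right _).eq] at this
      exact congrArg Prod.fst this
    obtain ⟨k, rfl⟩ := Nat.exists_eq_add_of_le' hn
    change (adjT^[k + 2] (adjT t)).1 = (adjT^[k + 3] (adjT t)).1
    rw [Function.iterate_add_apply, Function.iterate_add_apply, hst]

section Magma

/-- Two switches together with a ladder of `N + 1` rungs. -/
inductive Ladder (N : ℕ)
  | switch (b : Bool)
  | rung (j : Fin (N + 1))

namespace Ladder

variable {N : ℕ}

/-- A rung is advanced by the switch of its parity; all other products are left projections. -/
instance : Mul (Ladder N) where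
  mul
    | rung j, switch b => if j.val % 2 = b.toNat then rung (j + 1) else rung j
    | a, _ => a

theorem rung_mul_switch (j : Fin (N + 1)) (b : Bool) :
    rung j * switch b = if j.val % 2 = b.toNat then rung (j + 1) else rung j := rfl

instance : Finite (Ladder N) :=
  Finite.of_surjective (Sum.elim switch rung : Bool ⊕ Fin (N + 1) → Ladder N) fun
    | switch b => ⟨.inl b, rfl⟩
    | rung j => ⟨.inr j, rfl⟩

/-- The submagma of all rungs. -/
def rungs (N : ℕ) : Subsemigroup (Ladder N) where
  carrier := Set.range rung
  mul_mem' := by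
    rintro _ _ ⟨i, rfl⟩ ⟨j, rfl⟩
    exact ⟨i, rfl⟩

theorem val_add_one_le (j : Fin (N + 1)) : (j + 1).val ≤ j.val + 1 := by
  rw [Fin.val_add_one]
  split_ifs <;> omega

/-- One switch with the rungs below a bound of its parity. -/
def segment (N : ℕ) (b : Bool) (k : ℕ) : Subsemigroup (Ladder N) where
  carrier := {a | a = switch b ∨ ∃ j : Fin (N + 1), j.val < 2 * k + b.toNat ∧ a = rung j}
  mul_mem' := by
    rintro _ _ (rfl | ⟨i, hi, rfl⟩) (rfl | ⟨j, hj, rfl⟩)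
    · exact .inl rfl
    · exact .inl rfl
    · rw [rung_mul_switch]
      split_ifs with h
      · refine .inr ⟨_, ?_, rfl⟩
        have := val_add_one_le i
        omega
      · exact .inr ⟨i, hi, rfl⟩
    · exact .inr ⟨i, hi, rfl⟩

theorem switch_mem_segment {b c : Bool} {k : ℕ} : switch c ∈ segment N b k ↔ c = b := by
  change (_ ∨ _) ↔ _
  simp

theorem rung_mem_segment {b : Bool} {k : ℕ} {j : Fin (N + 1)} :
    rung j ∈ segment N b k ↔ j.val < 2 * k + b.toNat := by
  change (_ ∨ _) ↔ _
  simp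

theorem rung_mem_rungs (j : Fin (N + 1)) : rung j ∈ rungs N := ⟨j, rfl⟩

theorem switch_notMem_rungs (b : Bool) : switch b ∉ rungs N := by
  rintro ⟨j, hj⟩
  cases hj

theorem segment_sup_rungs_inf {b c : Bool} {k l m : ℕ}
    (h : 2 * l + c.toNat = 2 * k + b.toNat + 1) (hm : m = k + 1) :
    segment N b k ⊔ rungs N ⊓ segment N c l = segment N b m := by
  subst hm
  apply le_antisymm
  · refine sup_le ?_ ?_
    · rintro (d | j) ha
      · exact switch_mem_segment.2 (switch_mem_segment.1 ha)
      · have := rung_mem_segment.1 ha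
        exact rung_mem_segment.2 (by omega)
    · rintro (d | j) ⟨h₁, h₂⟩
      · exact absurd h₁ (switch_notMem_rungs d)
      · have := rung_mem_segment.1 h₂
        exact rung_mem_segment.2 (by omega)
  · have hs : switch b ∈ segment N b k ⊔ rungs N ⊓ segment N c l :=
      (le_sup_left : segment N b k ≤ _) (switch_mem_segment.2 rfl)
    have hr (j : Fin (N + 1)) (hj : j.val < 2 * k + b.toNat + 1) :
        rung j ∈ segment N b k ⊔ rungs N ⊓ segment N c l :=
      (le_sup_right : rungs N ⊓ segment N c l ≤ _)
        ⟨rung_mem_rungs j, rung_mem_segment.2 (by omega)⟩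
    rintro (d | j) ha
    · rwa [switch_mem_segment.1 ha]
    · have hj := rung_mem_segment.1 ha
      by_cases hlt : j.val < 2 * k + b.toNat + 1
      · exact hr j hlt
      · let i : Fin (N + 1) := ⟨2 * k + b.toNat, by omega⟩
        have hij : i + 1 = j := by
          apply Fin.ext
          rw [Fin.val_add_one_of_lt' (by simp only [i]; omega)]
          simp only [i]
          omega
        have hmul := mul_mem (hr i (Nat.lt_succ_self _)) hs
        have hb := b.toNat_lt
        rwa [rung_mul_switch, if_pos (by simp only [i]; omega), hij] at hmul

theorem rungs_sup_segment_inf (k l : ℕ) :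
    rungs N ⊔ segment N false k ⊓ segment N true l = rungs N := by
  refine sup_eq_left.2 ?_
  rintro (d | j) ⟨h₁, h₂⟩
  · have h₁ := switch_mem_segment.1 h₁
    have h₂ := switch_mem_segment.1 h₂
    simp_all
  · exact rung_mem_rungs j

theorem segment_sup_of_le {b c : Bool} {k l : ℕ} (h : 2 * l + c.toNat ≤ 2 * k + b.toNat) :
    segment N b k ⊔ segment N c l ⊓ rungs N = segment N b k := by
  refine sup_eq_left.2 ?_
  rintro (d | j) ⟨h₁, h₂⟩
  · exact absurd h₂ (switch_notMem_rungs d)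
  · have := rung_mem_segment.1 h₁
    exact rung_mem_segment.2 (by omega)

theorem adjT_segment_even (k : ℕ) :
    adjT (segment N false k, rungs N, segment N true k) =
      (segment N false (k + 1), rungs N, segment N true k) := by
  rw [adjT]
  simp only
  rw [segment_sup_rungs_inf (by simp) rfl, rungs_sup_segment_inf, segment_sup_of_le (by simp)]

theorem adjT_segment_odd (k : ℕ) :
    adjT (segment N false (k + 1), rungs N, segment N true k) =
      (segment N false (k + 1), rungs N, segment N true (k + 1)) := by
  rw [adjT]
  simp only
  rw [inf_comm (rungs N), segment_sup_of_le (by simp), rungs_sup_segment_inf,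
    inf_comm _ (rungs N), segment_sup_rungs_inf (by simp; omega) rfl]

theorem adjT_iterate_segment (k : ℕ) :
    adjT^[2 * k] (segment N false 0, rungs N, segment N true 0) =
      (segment N false k, rungs N, segment N true k) := by
  induction k with
  | zero => rfl
  | succ k ih =>
    rw [show 2 * (k + 1) = 2 * k + 1 + 1 by ring, Function.iterate_succ_apply',
      Function.iterate_succ_apply', ih, adjT_segment_even, adjT_segment_odd]

theorem not_nModular (n : ℕ) : ¬ NModular (Subsemigroup (Ladder (2 * n))) (2 * n) := fun h => by
  have h := h (segment _ false 0, rungs _, segment _ true 0)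
  rw [Function.iterate_succ_apply', adjT_iterate_segment, adjT_segment_even] at h
  have hmem : rung (Fin.last (2 * n)) ∈ segment (2 * n) false (n + 1) :=
    rung_mem_segment.2 (by simp)
  rw [← show segment (2 * n) false n = segment (2 * n) false (n + 1) from h,
    rung_mem_segment] at hmem
  simp at hmem

instance : Finite (Subsemigroup (Ladder N)) :=
  Finite.of_injective _ (SetLike.coe_injective (A := Subsemigroup (Ladder N)))

end Ladder

end Magma

/-- The pentagon: `0 < 1 < 2 < 4` and `0 < 3 < 4`. -/
def Pentagon : Type := Fin 5

namespace Pentagon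

instance : Fintype Pentagon := inferInstanceAs (Fintype (Fin 5))

instance : DecidableEq Pentagon := inferInstanceAs (DecidableEq (Fin 5))

/-- The join of the pentagon. -/
def join (a b : Fin 5) : Fin 5 :=
  if a = 0 then b else if b = 0 then a else if (a = 3) = (b = 3) then max a b else 4

/-- The meet of the pentagon. -/
def meet (a b : Fin 5) : Fin 5 :=
  if a = 4 then b else if b = 4 then a else if (a = 3) = (b = 3) then min a b else 0

instance : Max Pentagon := ⟨join⟩

instance : Min Pentagon := ⟨meet⟩

instance : Lattice Pentagon :=
  Lattice.mk' (by decide) (by decide) (by decide) (by decide) (by decide) (by decide)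

theorem nModular_two : NModular Pentagon 2 := by
  rintro ⟨x, y, z⟩
  revert x y z
  set_option maxRecDepth 10000 in decide

theorem not_nModular_one : ¬ NModular Pentagon 1 := fun h =>
  absurd (h ((1 : Fin 5), (3 : Fin 5), (2 : Fin 5))) (by decide)

end Pentagon

/-- For every `n ≥ 1` there is a finite lattice that is `(n+1)`-modular but not `n`-modular;
together with the (always valid) inclusion, this says that the class of `n`-modular lattices
is properly contained in the class of `(n+1)`-modular lattices. -/
theorem stmt7 (n : ℕ) (hn : 1 ≤ n) :
    (∃ (α : Type) (_ : Lattice α), Finite α ∧ NModular α (n + 1) ∧ ¬ NModular α n) ∧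
    (∀ (β : Type*) [Lattice β], NModular β n → NModular β (n + 1)) := by
  refine ⟨?_, fun β _ h => h.succ⟩
  obtain rfl | hn := hn.eq_or_lt
  · exact ⟨Pentagon, inferInstance, inferInstance, Pentagon.nModular_two,
      Pentagon.not_nModular_one⟩
  · exact exists_nModular_succ_of_not_nModular (α := Subsemigroup (Ladder (2 * n))) hn fun h =>
      Ladder.not_nModular n (h.mono (by omega))
end

section
/- Let A and B be lattices with least elements 0 such that the tensor product A ⊗ B is capped. Then for every I ∈ A ⊗ B and every x ∈ A with x ≠ 0 there is a largest element φ_I(x) ∈ B with (x, φ_I(x)) ∈ I, the map φ_I satisfies φ_I(x₀ ⊔ x₁) = φ_I(x₀) ⊓ φ_I(x₁) for all nonzero x₀, x₁ ∈ A, and the assignment I ↦ φ_I is an order isomorphism from A ⊗ B (ordered by inclusion) onto Hom_∨(A⁻, B^d), the set of all maps φ : A ∖ {0} → B satisfying φ(x₀ ⊔ x₁) = φ(x₀) ⊓ φ(x₁), ordered pointwise by the order of B. -/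
section TensorDefs

variable {α β : Type*} [Lattice α] [OrderBot α] [Lattice β] [OrderBot β]

/-- `∇ = (A × {0}) ∪ ({0} × B)`. -/
def nablaSet (α β : Type*) [Lattice α] [OrderBot α] [Lattice β] [OrderBot β] :
    Set (α × β) :=
  {p | p.1 = ⊥ ∨ p.2 = ⊥}

/-- A *bi-ideal* of `A × B`: a down-set containing `∇` and closed under joins in each
coordinate separately. -/
def IsBiIdeal (I : Set (α × β)) : Prop :=
  IsLowerSet I ∧ nablaSet α β ⊆ I ∧
  (∀ a₀ a₁ b, (a₀, b) ∈ I → (a₁, b) ∈ I → (a₀ ⊔ a₁, b) ∈ I) ∧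
  (∀ a b₀ b₁, (a, b₀) ∈ I → (a, b₁) ∈ I → (a, b₀ ⊔ b₁) ∈ I)

/-- Membership in the tensor product `A ⊗ B`: the bi-ideals that are finite joins of
pure tensors `a ⊗ b`, i.e. the smallest bi-ideal containing some finite subset of `A × B`. -/
def InTensor (I : Set (α × β)) : Prop :=
  ∃ s : Finset (α × β), I = ⋂₀ {J : Set (α × β) | IsBiIdeal J ∧ ↑s ⊆ J}

/-- A bi-ideal is *capped* if it is `∇` together with the down-set generated by a finite set. -/
def IsCapped (I : Set (α × β)) : Prop :=
  ∃ s : Finset (α × β), I = nablaSet α β ∪ {p | ∃ q ∈ s, p.1 ≤ q.1 ∧ p.2 ≤ q.2}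

end TensorDefs

section Hypograph

variable {α β : Type*} [LE α] [OrderBot α] [Preorder β]

/-- The region below the graph of `φ`, together with the whole fibre over `⊥`. -/
def hypographSet (φ : {x : α // x ≠ ⊥} → β) : Set (α × β) :=
  {p | ∀ hp : p.1 ≠ ⊥, p.2 ≤ φ ⟨p.1, hp⟩}

theorem isGreatest_hypographSet (φ : {x : α // x ≠ ⊥} → β) (x : {x : α // x ≠ ⊥}) :
    IsGreatest {y : β | ((x : α), y) ∈ hypographSet φ} (φ x) :=
  ⟨fun _ => le_rfl, fun _ hy => hy x.2⟩

theorem hypographSet_subset_iff {φ ψ : {x : α // x ≠ ⊥} → β} :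
    hypographSet φ ⊆ hypographSet ψ ↔ φ ≤ ψ :=
  ⟨fun h x => h (a := ((x : α), φ x)) (fun _ => le_rfl) x.2,
    fun h _ hp hx => (hp hx).trans (h _)⟩

end Hypograph

section TensorLemmas

variable {α β : Type*} [Lattice α] [OrderBot α] [Lattice β] [OrderBot β]

theorem isBiIdeal_sInter {S : Set (Set (α × β))} (hS : ∀ J ∈ S, IsBiIdeal J) :
    IsBiIdeal (⋂₀ S) := by
  refine ⟨isLowerSet_sInter fun J hJ => (hS J hJ).1,
    Set.subset_sInter fun J hJ => (hS J hJ).2.1, ?_, ?_⟩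
  · exact fun a₀ a₁ b h₀ h₁ J hJ => (hS J hJ).2.2.1 a₀ a₁ b (h₀ J hJ) (h₁ J hJ)
  · exact fun a b₀ b₁ h₀ h₁ J hJ => (hS J hJ).2.2.2 a b₀ b₁ (h₀ J hJ) (h₁ J hJ)

theorem InTensor.isBiIdeal {I : Set (α × β)} (h : InTensor I) : IsBiIdeal I := by
  obtain ⟨s, rfl⟩ := h
  exact isBiIdeal_sInter fun J hJ => hJ.1

/-- A capped bi-ideal is the bi-ideal generated by a finite set of caps. -/
theorem IsBiIdeal.inTensor {I : Set (α × β)} (h : IsBiIdeal I) (hc : IsCapped I) :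
    InTensor I := by
  obtain ⟨s, hs⟩ := hc
  have hsI : (s : Set (α × β)) ⊆ I := fun q hq => by
    rw [hs]
    exact Or.inr ⟨q, hq, le_rfl, le_rfl⟩
  refine ⟨s, Set.Subset.antisymm ?_ (Set.sInter_subset_of_mem ⟨h, hsI⟩)⟩
  rintro p hp J ⟨hJ, hsJ⟩
  rw [hs] at hp
  rcases hp with hp | ⟨q, hq, hpq⟩
  · exact hJ.2.1 hp
  · exact hJ.1 (Prod.le_def.2 hpq) (hsJ hq)

theorem IsBiIdeal.mk_finset_sup_mem {ι : Type*} {I : Set (α × β)} (h : IsBiIdeal I) (x : α)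
    (t : Finset ι) (f : ι → β) (ht : ∀ i ∈ t, (x, f i) ∈ I) : (x, t.sup f) ∈ I :=
  Finset.sup_induction (p := fun y => (x, y) ∈ I) (h.2.1 (Or.inr rfl))
    (fun y₀ h₀ y₁ h₁ => h.2.2.2 x y₀ y₁ h₀ h₁) ht

/-- The section of a capped bi-ideal above a nonzero element has a greatest element. -/
theorem IsBiIdeal.exists_isGreatest {I : Set (α × β)} (h : IsBiIdeal I) (hc : IsCapped I)
    {x : α} (hx : x ≠ ⊥) : ∃ y : β, IsGreatest {y' : β | (x, y') ∈ I} y := by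
  classical
  obtain ⟨s, hs⟩ := hc
  refine ⟨(s.filter fun q => x ≤ q.1).sup Prod.snd, ?_, ?_⟩
  · refine h.mk_finset_sup_mem x _ _ fun q hq => ?_
    rw [Finset.mem_filter] at hq
    rw [hs]
    exact Or.inr ⟨q, hq.1, hq.2, le_rfl⟩
  · intro y hy
    rw [Set.mem_ofPred_eq, hs] at hy
    rcases hy with (hy | hy) | ⟨q, hq, hxq, hyq⟩
    · exact absurd hy hx
    · exact (show y = ⊥ from hy).trans_le bot_le
    · exact hyq.trans
        (Finset.le_sup (f := Prod.snd) (Finset.mem_filter.2 ⟨hq, hxq⟩))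

theorem IsBiIdeal.isGreatest_sup {I : Set (α × β)} (h : IsBiIdeal I) {x₀ x₁ : α}
    {y₀ y₁ y₂ : β} (h₀ : IsGreatest {y' : β | (x₀, y') ∈ I} y₀)
    (h₁ : IsGreatest {y' : β | (x₁, y') ∈ I} y₁)
    (h₂ : IsGreatest {y' : β | (x₀ ⊔ x₁, y') ∈ I} y₂) : y₂ = y₀ ⊓ y₁ := by
  apply le_antisymm
  · exact le_inf (h₀.2 (h.1 (Prod.mk_le_mk.2 ⟨le_sup_left, le_rfl⟩) h₂.1))
      (h₁.2 (h.1 (Prod.mk_le_mk.2 ⟨le_sup_right, le_rfl⟩) h₂.1))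
  · exact h₂.2 (h.2.2.1 _ _ _ (h.1 (Prod.mk_le_mk.2 ⟨le_rfl, inf_le_left⟩) h₀.1)
      (h.1 (Prod.mk_le_mk.2 ⟨le_rfl, inf_le_right⟩) h₁.1))

theorem isBiIdeal_hypographSet {φ : {x : α // x ≠ ⊥} → β}
    (hφ : ∀ x₀ x₁ x₂ : {x : α // x ≠ ⊥}, (x₂ : α) = (x₀ : α) ⊔ (x₁ : α) →
      φ x₂ = φ x₀ ⊓ φ x₁) : IsBiIdeal (hypographSet φ) := by
  refine ⟨?_, ?_, ?_, ?_⟩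
  · rintro ⟨a, b⟩ ⟨c, d⟩ hle hab hc
    obtain ⟨hca, hdb⟩ := Prod.mk_le_mk.1 hle
    have ha : a ≠ ⊥ := fun h => hc (le_bot_iff.1 (h ▸ hca))
    have := hφ ⟨c, hc⟩ ⟨a, ha⟩ ⟨a, ha⟩ (sup_eq_right.2 hca).symm
    exact (hdb.trans (hab ha)).trans (this.trans_le inf_le_left)
  · rintro ⟨a, b⟩ (h | h) ha
    · exact absurd h ha
    · exact (show b = ⊥ from h).trans_le bot_le
  · intro a₀ a₁ b h₀ h₁ h
    by_cases e₀ : a₀ = ⊥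
    · subst e₀
      simp only [bot_sup_eq] at h ⊢
      exact h₁ h
    by_cases e₁ : a₁ = ⊥
    · subst e₁
      simp only [sup_bot_eq] at h ⊢
      exact h₀ h
    rw [hφ ⟨a₀, e₀⟩ ⟨a₁, e₁⟩ ⟨a₀ ⊔ a₁, h⟩ rfl]
    exact le_inf (h₀ e₀) (h₁ e₁)
  · exact fun a b₀ b₁ h₀ h₁ h => sup_le (h₀ h) (h₁ h)

/-- A bi-ideal is recovered from the greatest elements of its sections. -/
theorem IsBiIdeal.eq_hypographSet {I : Set (α × β)} (h : IsBiIdeal I)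
    {φ : {x : α // x ≠ ⊥} → β}
    (hφ : ∀ x : {x : α // x ≠ ⊥}, IsGreatest {y : β | ((x : α), y) ∈ I} (φ x)) :
    I = hypographSet φ := by
  ext ⟨a, b⟩
  refine ⟨fun hab ha => (hφ ⟨a, ha⟩).2 hab, fun hab => ?_⟩
  by_cases ha : a = ⊥
  · exact h.2.1 (Or.inl ha)
  · exact h.1 (Prod.mk_le_mk.2 ⟨le_rfl, hab ha⟩) (hφ ⟨a, ha⟩).1

end TensorLemmas

/-- Let `A`, `B` be lattices with zero whose tensor product is capped (every bi-ideal is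
capped).  Then for `I ∈ A ⊗ B` and `0 ≠ x ∈ A` there is a largest `φ_I(x) ∈ B` with
`(x, φ_I(x)) ∈ I`; the map `φ_I` turns joins into meets
(`φ_I(x₀ ⊔ x₁) = φ_I(x₀) ⊓ φ_I(x₁)`); and `I ↦ φ_I` is an order isomorphism from `A ⊗ B`
(ordered by inclusion) onto `Hom_∨(A⁻, Bᵈ)` (ordered pointwise in `B`). -/
theorem stmt10 {α β : Type*} [Lattice α] [OrderBot α] [Lattice β] [OrderBot β]
    (hcap : ∀ I : Set (α × β), IsBiIdeal I → IsCapped I) :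
    (∀ I : Set (α × β), InTensor I → ∀ x : α, x ≠ ⊥ →
      ∃ y : β, IsGreatest {y' : β | (x, y') ∈ I} y) ∧
    (∀ I : Set (α × β), InTensor I → ∀ x₀ x₁ : α, x₀ ≠ ⊥ → x₁ ≠ ⊥ →
      ∀ y₀ y₁ y₂ : β, IsGreatest {y' : β | (x₀, y') ∈ I} y₀ →
        IsGreatest {y' : β | (x₁, y') ∈ I} y₁ →
        IsGreatest {y' : β | (x₀ ⊔ x₁, y') ∈ I} y₂ → y₂ = y₀ ⊓ y₁) ∧
    (∃ e : {I : Set (α × β) // InTensor I} ≃o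
        {φ : {x : α // x ≠ ⊥} → β //
          ∀ x₀ x₁ x₂ : {x : α // x ≠ ⊥}, (x₂ : α) = (x₀ : α) ⊔ (x₁ : α) →
            φ x₂ = φ x₀ ⊓ φ x₁},
      ∀ (I : {I : Set (α × β) // InTensor I}) (x : {x : α // x ≠ ⊥}),
        IsGreatest {y' : β | ((x : α), y') ∈ (I : Set (α × β))} ((e I).val x)) := by
  have hex : ∀ I : Set (α × β), InTensor I → ∀ x : α, x ≠ ⊥ →
      ∃ y : β, IsGreatest {y' : β | (x, y') ∈ I} y := fun I hI _ hx =>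
    hI.isBiIdeal.exists_isGreatest (hcap I hI.isBiIdeal) hx
  refine ⟨hex, fun I hI x₀ x₁ _ _ y₀ y₁ y₂ h₀ h₁ h₂ =>
    hI.isBiIdeal.isGreatest_sup h₀ h₁ h₂, ?_⟩
  choose f hf using fun (I : {I : Set (α × β) // InTensor I}) (x : {x : α // x ≠ ⊥}) =>
    hex I.1 I.2 x.1 x.2
  have hI : ∀ I : {I : Set (α × β) // InTensor I}, I.1 = hypographSet (f I) :=
    fun I => I.2.isBiIdeal.eq_hypographSet (hf I)
  refine ⟨{ toFun := fun I => ⟨f I, fun x₀ x₁ x₂ h =>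
              I.2.isBiIdeal.isGreatest_sup (hf I x₀) (hf I x₁) (h ▸ hf I x₂)⟩
            invFun := fun φ => ⟨hypographSet φ.1,
              (isBiIdeal_hypographSet φ.2).inTensor (hcap _ (isBiIdeal_hypographSet φ.2))⟩
            left_inv := fun I => Subtype.ext (hI I).symm
            right_inv := fun φ => Subtype.ext <| funext fun x =>
              (hf _ x).unique (isGreatest_hypographSet φ.1 x)
            map_rel_iff' := ?_ }, hf⟩
  intro I J
  change f I ≤ f J ↔ I.1 ⊆ J.1
  rw [hI I, hI J, hypographSet_subset_iff]
end
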